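/- (Sharp Gehring lemma, n = 1, p = 1.) Let Q > 0 and let ε_− be the unique positive solution of 1/t − log(1/t + 1) = Q, and set γ_+ = 1 + 1/ε_− (equivalently, γ_+ > 1 is the larger root of γ − log γ = Q + 1). Let w be a weight on ℝ such that w·log w is locally integrable and [w]_{RH_1} ≤ Q. Then for every ε with 0 < ε < ε_−, one has for every bounded interval I of positive length: ⟨w^{1+ε}⟩_I ≤ γ_+^{−ε}·(1 − ε(γ_+ − 1))^{−1}·(⟨w⟩_I)^{1+ε}. In particular w ∈ RH_{1+ε}. -/

import Mathlib

open MeasureTheory Real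

/-- The average `⟨f⟩_{(a,b)} = (b-a)⁻¹ ∫_a^b f` of a function over a bounded interval. -/
noncomputable def intAvg (f : ℝ → ℝ) (a b : ℝ) : ℝ := (b - a)⁻¹ * ∫ t in a..b, f t

section Helpers

open Set Filter Topology

/-- A connected component of a bounded open subset of the line is an open interval whose endpoints
lie outside the set. -/
theorem exists_connectedComponentIn_eq_Ioo {U : Set ℝ} (hU : IsOpen U) (hbb : BddBelow U)
    (hba : BddAbove U) {x : ℝ} (hx : x ∈ U) :
    ∃ c e : ℝ, c < e ∧ c ∉ U ∧ e ∉ U ∧ connectedComponentIn U x = Ioo c e := by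
  set S := connectedComponentIn U x with hS
  have hxS : x ∈ S := mem_connectedComponentIn hx
  have hSU : S ⊆ U := connectedComponentIn_subset U x
  have hSo : IsOpen S := hU.connectedComponentIn
  have hSp : IsPreconnected S := isPreconnected_connectedComponentIn
  have hb1 : BddBelow S := hbb.mono hSU
  have hb2 : BddAbove S := hba.mono hSU
  have closure_inter : ∀ c ∈ closure S, c ∈ U → c ∈ S := by
    intro c hc hcU
    have ho : IsOpen (connectedComponentIn U c) := hU.connectedComponentIn
    obtain ⟨z, hz1, hz2⟩ :=
      mem_closure_iff.1 hc _ ho (mem_connectedComponentIn hcU)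
    rw [hS, connectedComponentIn_eq hz2, ← connectedComponentIn_eq hz1]
    exact mem_connectedComponentIn hcU
  have hc : sInf S ∉ S := by
    intro h
    obtain ⟨l, hl, hl'⟩ := (mem_nhdsLE_iff_exists_Ioc_subset).1
      (mem_nhdsWithin_of_mem_nhds (hSo.mem_nhds h) : S ∈ 𝓝[≤] (sInf S))
    obtain ⟨z, hz1, hz2⟩ := exists_between (mem_Iio.1 hl)
    exact absurd (csInf_le hb1 (hl' ⟨hz1, hz2.le⟩)) (not_le.2 hz2)
  have he : sSup S ∉ S := by
    intro h
    obtain ⟨l, hl, hl'⟩ := (mem_nhdsGE_iff_exists_Ico_subset).1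
      (mem_nhdsWithin_of_mem_nhds (hSo.mem_nhds h) : S ∈ 𝓝[≥] (sSup S))
    obtain ⟨z, hz1, hz2⟩ := exists_between (mem_Ioi.1 hl)
    exact absurd (le_csSup hb2 (hl' ⟨hz1.le, hz2⟩)) (not_le.2 hz1)
  have hsub : S ⊆ Ioo (sInf S) (sSup S) := fun z hz =>
    ⟨lt_of_le_of_ne (csInf_le hb1 hz) (fun h => hc (h ▸ hz)),
      lt_of_le_of_ne (le_csSup hb2 hz) (fun h => he (h ▸ hz))⟩
  refine ⟨sInf S, sSup S, (hsub hxS).1.trans (hsub hxS).2, ?_, ?_, ?_⟩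
  · exact fun h => hc (closure_inter _ (csInf_mem_closure ⟨x, hxS⟩ hb1) h)
  · exact fun h => he (closure_inter _ (csSup_mem_closure ⟨x, hxS⟩ hb2) h)
  · exact hsub.antisymm (IsConnected.Ioo_csInf_csSup_subset ⟨⟨x, hxS⟩, hSp⟩ hb1 hb2)

/-- If a function has nonpositive integral over every maximal interval of a bounded open set, then
it has nonpositive integral over the whole set. -/
theorem setIntegral_nonpos_of_forall_component {U : Set ℝ} (hU : IsOpen U) (hbb : BddBelow U)
    (hba : BddAbove U) {f : ℝ → ℝ} (hf : IntegrableOn f U)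
    (h : ∀ c e : ℝ, c < e → Ioo c e ⊆ U → c ∉ U → e ∉ U → ∫ t in c..e, f t ≤ 0) :
    ∫ t in U, f t ≤ 0 := by
  let C : Set (Set ℝ) := connectedComponentIn U '' U
  have hopen : ∀ s ∈ C, IsOpen s := by
    rintro _ ⟨x, -, rfl⟩
    exact hU.connectedComponentIn
  have hdisj : C.PairwiseDisjoint id := by
    rintro _ ⟨x, hx, rfl⟩ _ ⟨y, hy, rfl⟩ hne
    refine Set.disjoint_left.2 fun z hz1 hz2 => hne ?_
    change z ∈ connectedComponentIn U x at hz1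
    change z ∈ connectedComponentIn U y at hz2
    rw [connectedComponentIn_eq hz1, connectedComponentIn_eq hz2]
  have hcount : C.Countable := hdisj.countable_of_isOpen (fun s hs => hopen s hs) (by
    rintro _ ⟨x, hx, rfl⟩
    exact ⟨x, mem_connectedComponentIn hx⟩)
  have hUC : U = ⋃ s : C, (s : Set ℝ) := by
    ext x
    simp only [mem_iUnion, Subtype.exists, exists_prop]
    constructor
    · exact fun hx => ⟨_, ⟨x, hx, rfl⟩, mem_connectedComponentIn hx⟩
    · rintro ⟨_, ⟨y, hy, rfl⟩, hx⟩
      exact connectedComponentIn_subset U y hx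
  have := hcount.to_subtype
  have hdisj' : Pairwise (Function.onFun Disjoint (fun s : C => (s : Set ℝ))) := by
    intro s t hst
    exact hdisj s.2 t.2 (fun h => hst (Subtype.ext h))
  rw [hUC, integral_iUnion (fun s : C => (hopen s s.2).measurableSet) hdisj' (hUC ▸ hf)]
  refine tsum_nonpos ?_
  rintro ⟨_, x, hx, rfl⟩
  obtain ⟨c, e, hce, hc, he, heq⟩ := exists_connectedComponentIn_eq_Ioo hU hbb hba hx
  simp only [heq]
  rw [← integral_Ioc_eq_integral_Ioo, ← intervalIntegral.integral_of_le hce.le]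
  exact h c e hce (heq ▸ connectedComponentIn_subset U x) hc he

/-- The points of `(a, b)` from which `F` can still rise, either above its current value or above
`0`. -/
def riseSet (F : ℝ → ℝ) (a b : ℝ) : Set ℝ :=
  {x | x ∈ Ioo a b ∧ ∃ y ∈ Ioc x b, min (F x) 0 < F y}

theorem isOpen_riseSet {F : ℝ → ℝ} (hF : Continuous F) (a b : ℝ) :
    IsOpen (riseSet F a b) := by
  rw [isOpen_iff_mem_nhds]
  rintro x ⟨hx, y, hy, hxy⟩
  have h1 : ∀ᶠ z in 𝓝 x, min (F z) 0 < F y :=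
    (hF.min continuous_const).continuousAt.eventually_lt continuousAt_const hxy
  filter_upwards [h1, Ioo_mem_nhds hx.1 hx.2, Iio_mem_nhds hy.1] with z hz1 hz2 hz3
  exact ⟨hz2, y, ⟨hz3, hy.2⟩, hz1⟩

/-- A two-sided version of the rising sun lemma on a bounded interval. -/
theorem eq_of_riseSet_component {F : ℝ → ℝ} (hF : Continuous F) {a b : ℝ} (ha : F a = 0)
    (hb : F b ≤ 0) {c e : ℝ} (hce : c < e) (hsub : Ioo c e ⊆ riseSet F a b)
    (hc : c ∉ riseSet F a b) (he : e ∉ riseSet F a b) : a ≤ c ∧ e ≤ b ∧ F c = F e := by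
  have hIcc : Icc c e ⊆ Icc a b := by
    have hab : Ioo c e ⊆ Ioo a b := fun x hx => (hsub hx).1
    obtain ⟨x, hx⟩ := exists_between hce
    have := hab hx
    rw [← closure_Ioo hce.ne, ← closure_Ioo (this.1.trans this.2).ne]
    exact closure_mono hab
  have hac : a ≤ c := (hIcc (left_mem_Icc.2 hce.le)).1
  have heb : e ≤ b := (hIcc (right_mem_Icc.2 hce.le)).2
  have key : ∀ x, x ∈ Ico a b → (x ∉ Ioo a b ∨ x ∉ riseSet F a b) →
      F x ≤ 0 ∧ (a < x → ∀ y ∈ Icc x b, F y ≤ F x) := by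
    intro x hx hx'
    rcases hx.1.eq_or_lt with rfl | hax
    · exact ⟨ha.le, fun h => absurd h (lt_irrefl _)⟩
    have hxr : x ∉ riseSet F a b := by
      rcases hx' with h | h
      · exact absurd ⟨hax, hx.2⟩ h
      · exact h
    have hy : ∀ y ∈ Ioc x b, F y ≤ min (F x) 0 := by
      intro y hy
      by_contra hlt
      exact hxr ⟨⟨hax, hx.2⟩, y, hy, not_le.1 hlt⟩
    have hx0 : F x ≤ 0 := by
      have hcl : x ∈ closure (Ioc x b) := by
        rw [closure_Ioc hx.2.ne]; exact left_mem_Icc.2 hx.2.le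
      exact (isClosed_le hF continuous_const).closure_subset_iff.2
        (fun y hy' => (hy y hy').trans (min_le_right _ _)) hcl
    refine ⟨hx0, fun _ y hy' => ?_⟩
    rcases hy'.1.eq_or_lt with rfl | h
    · exact le_rfl
    · exact (hy y ⟨h, hy'.2⟩).trans (min_le_left _ _)
  have hFe : F e ≤ 0 ∧ ∀ y ∈ Icc e b, F y ≤ F e := by
    rcases heb.eq_or_lt with rfl | heb'
    · exact ⟨hb, fun y hy => by rw [le_antisymm hy.2 hy.1]⟩
    · have := key e ⟨hac.trans hce.le, heb'⟩ (Or.inr he)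
      exact ⟨this.1, this.2 (hac.trans_lt hce)⟩
  have hFc := key c ⟨hac, hce.trans_le heb⟩ (Or.inr hc)
  have hmin : ∀ x ∈ Ioo c e, min (F x) 0 ≤ F e := by
    intro x hx
    by_contra! hlt
    set K : Set ℝ := Icc x e ∩ {z | min (F x) 0 ≤ min (F z) 0} with hK
    have hKc : IsCompact K := isCompact_Icc.inter_right
      (isClosed_le continuous_const (hF.min continuous_const))
    obtain ⟨z, hz⟩ := hKc.exists_isGreatest ⟨x, left_mem_Icc.2 hx.2.le, le_refl (min (F x) 0)⟩
    have hze : z < e := by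
      refine lt_of_le_of_ne hz.1.1.2 ?_
      rintro rfl
      exact absurd (hz.1.2.trans (min_le_left _ _)) (not_le.2 hlt)
    obtain ⟨-, y, hy, hyz⟩ := hsub ⟨hx.1.trans_le hz.1.1.1, hze⟩
    have hmy : min (F x) 0 < F y := lt_of_le_of_lt hz.1.2 hyz
    rcases le_or_gt e y with hey | hey
    · exact absurd (hFe.2 y ⟨hey, hy.2⟩) (not_le.2 (hlt.trans hmy))
    · exact absurd (hz.2 ⟨⟨hz.1.1.1.trans hy.1.le, hey.le⟩, le_min hmy.le (min_le_right _ _)⟩)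
        (not_le.2 hy.1)
  have hce' : F c ≤ F e := by
    have hcl : c ∈ closure (Ioo c e) := by
      rw [closure_Ioo hce.ne]; exact left_mem_Icc.2 hce.le
    have := (isClosed_le (hF.min continuous_const) (continuous_const (y := F e))).closure_subset_iff.2
      hmin hcl
    rwa [mem_ofPred_eq, min_eq_left hFc.1] at this
  refine ⟨hac, heb, le_antisymm hce' ?_⟩
  rcases hac.eq_or_lt with rfl | h
  · exact ha ▸ hFe.1
  · exact hFc.2 h e ⟨hce.le, heb⟩

/-- `γ^ε (1 - ε (γ - 1)) ≤ 1`. -/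
theorem one_sub_mul_rpow_le_one {g ε : ℝ} (hg : 1 < g) (hε : 0 < ε) (hD : 0 < 1 - ε * (g - 1)) :
    (1 - ε * (g - 1)) * g ^ ε ≤ 1 := by
  have hg0 : 0 < g := by linarith
  rw [← Real.log_nonpos_iff (by positivity), Real.log_mul hD.ne' (by positivity),
    Real.log_rpow hg0]
  have h1 := Real.log_le_sub_one_of_pos hD
  have h2 := mul_le_mul_of_nonneg_left (Real.log_le_sub_one_of_pos hg0) hε.le
  linarith

/-- The scalar inequality behind the sharp constant, normalised to be an equality at `u = 1`. -/
theorem mul_rpow_le_log_of_le {g ε : ℝ} (hg : 1 < g) (hε : 0 < ε) (hD : 0 < 1 - ε * (g - 1))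
    {u : ℝ} (hu : 0 < u) (hug : u ≤ g) :
    (1 - ε * (g - 1)) * u ^ ε ≤
      ε * (1 + ε) * (Real.log u - g) + (1 + ε) + ε ^ 2 * g / u := by
  set D := 1 - ε * (g - 1) with hDdef
  have hDg := one_sub_mul_rpow_le_one hg hε hD
  have hg0 : 0 < g := by linarith
  have hconv : ConvexOn ℝ (Ici 0) fun x : ℝ => x ^ (1 + ε) := convexOn_rpow (by linarith)
  have hgp : D * g ^ (1 + ε) ≤ g := by
    rw [Real.rpow_add hg0, Real.rpow_one]; nlinarith
  have hright : ∀ x, 1 ≤ x → x ≤ g → D * x ^ (1 + ε) ≤ (1 + ε) * x - ε * g := by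
    intro x hx1 hxg
    have hgm : 0 < g - 1 := by linarith
    have := hconv.2 (mem_Ici.2 zero_le_one) (mem_Ici.2 hg0.le)
      (div_nonneg (by linarith) hgm.le : 0 ≤ (g - x) / (g - 1))
      (div_nonneg (by linarith) hgm.le : 0 ≤ (x - 1) / (g - 1))
      (by field_simp; ring)
    have e1 : (g - x) / (g - 1) * 1 + (x - 1) / (g - 1) * g = x := by field_simp; ring
    simp only [smul_eq_mul, Real.one_rpow] at this
    rw [e1] at this
    have h3 := mul_le_mul_of_nonneg_left this hD.le
    have h4 : D * ((g - x) / (g - 1) * 1 + (x - 1) / (g - 1) * g ^ (1 + ε)) ≤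
        (g - x) / (g - 1) * D + (x - 1) / (g - 1) * g := by
      have : 0 ≤ (x - 1) / (g - 1) := div_nonneg (by linarith) hgm.le
      nlinarith
    have h5 : (g - x) / (g - 1) * D + (x - 1) / (g - 1) * g = (1 + ε) * x - ε * g := by
      rw [hDdef]; field_simp; ring
    linarith
  have hleft : ∀ x, 0 < x → x ≤ 1 → (1 + ε) * x - ε * g ≤ D * x ^ (1 + ε) := by
    intro x hx0 hx1
    have hgm : 0 < g - x := by linarith
    have := hconv.2 (mem_Ici.2 hx0.le) (mem_Ici.2 hg0.le)
      (div_nonneg (by linarith) hgm.le : 0 ≤ (g - 1) / (g - x))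
      (div_nonneg (by linarith) hgm.le : 0 ≤ (1 - x) / (g - x))
      (by field_simp; ring)
    have e1 : (g - 1) / (g - x) * x + (1 - x) / (g - x) * g = 1 := by field_simp; ring
    simp only [smul_eq_mul] at this
    rw [e1, Real.one_rpow] at this
    have h2 : g - x ≤ (g - 1) * x ^ (1 + ε) + (1 - x) * g ^ (1 + ε) := by
      have := mul_le_mul_of_nonneg_left this hgm.le
      calc g - x = (g - x) * 1 := by ring
        _ ≤ _ := this
        _ = _ := by field_simp
    have h3 := mul_le_mul_of_nonneg_left h2 hD.le
    have h4 := mul_le_mul_of_nonneg_left hgp (by linarith : 0 ≤ 1 - x)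
    have h5 : D * (g - x) - (1 - x) * g = (g - 1) * ((1 + ε) * x - ε * g) := by
      rw [hDdef]; ring
    have h6 : (g - 1) * ((1 + ε) * x - ε * g) ≤ (g - 1) * (D * x ^ (1 + ε)) := by nlinarith
    exact le_of_mul_le_mul_left h6 (by linarith)
  let k : ℝ → ℝ := fun x =>
    ε * (1 + ε) * (Real.log x - g) + (1 + ε) + ε ^ 2 * g / x - D * x ^ ε
  have hder : ∀ x, 0 < x →
      HasDerivAt k (ε / x ^ 2 * ((1 + ε) * x - ε * g - D * x ^ (1 + ε))) x := by
    intro x hx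
    have h1 := (((Real.hasDerivAt_log hx.ne').sub_const g).const_mul (ε * (1 + ε))).add_const (1 + ε)
    have h2 := (hasDerivAt_inv hx.ne').const_mul (ε ^ 2 * g)
    have h3 := (Real.hasDerivAt_rpow_const (p := ε) (Or.inl hx.ne')).const_mul D
    refine ((h1.add h2).sub h3).congr_deriv ?_
    rw [Real.rpow_sub_one hx.ne', Real.rpow_add hx, Real.rpow_one]
    field_simp
    ring
  have hk1 : k 1 = 0 := by
    simp only [k, Real.log_one, Real.one_rpow, hDdef]; ring
  suffices 0 ≤ k u by simp only [k] at this; linarith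
  rw [← hk1]
  rcases le_total u 1 with h | h
  · have hanti : AntitoneOn k (Icc u 1) := by
      refine antitoneOn_of_deriv_nonpos (convex_Icc u 1)
        (fun x hx => (hder x (hu.trans_le hx.1)).continuousAt.continuousWithinAt) ?_ ?_
      · intro x hx
        rw [interior_Icc] at hx
        exact (hder x (hu.trans hx.1)).differentiableAt.differentiableWithinAt
      · intro x hx
        rw [interior_Icc] at hx
        have hx0 := hu.trans hx.1
        rw [(hder x hx0).deriv]
        exact mul_nonpos_of_nonneg_of_nonpos (by positivity) (by linarith [hleft x hx0 hx.2.le])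
    exact hanti (left_mem_Icc.2 h) (right_mem_Icc.2 h) h
  · have hmono : MonotoneOn k (Icc 1 u) := by
      refine monotoneOn_of_deriv_nonneg (convex_Icc 1 u)
        (fun x hx => (hder x (by linarith [hx.1])).continuousAt.continuousWithinAt) ?_ ?_
      · intro x hx
        rw [interior_Icc] at hx
        exact (hder x (by linarith [hx.1])).differentiableAt.differentiableWithinAt
      · intro x hx
        rw [interior_Icc] at hx
        have hx0 : 0 < x := by linarith [hx.1]
        rw [(hder x hx0).deriv]
        exact mul_nonneg (by positivity) (by linarith [hright x hx.1.le (hx.2.le.trans hug)])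
    exact hmono (left_mem_Icc.2 h) (right_mem_Icc.2 h) h

/-- The homogeneous primitive
`∫ t^(ε-1) (v log v - (Q+1) v - v log t + t) dt` evaluated at `t`. -/
noncomputable def gehringPrimitive (Q ε t v : ℝ) : ℝ :=
  t ^ ε / ε * (v * Real.log v - (Q + 1) * v) - v * (t ^ ε / ε * Real.log t - t ^ ε / ε ^ 2)
    + t ^ (1 + ε) / (1 + ε)

theorem hasDerivAt_gehringPrimitive {Q ε t v : ℝ} (hε : 0 < ε) (ht : 0 < t) :
    HasDerivAt (fun t => gehringPrimitive Q ε t v)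
      (t ^ (ε - 1) * (v * Real.log v - (Q + 1) * v - v * Real.log t + t)) t := by
  have h1 : HasDerivAt (fun t : ℝ => t ^ ε) (ε * t ^ (ε - 1)) t :=
    Real.hasDerivAt_rpow_const (Or.inl ht.ne')
  have h2 : HasDerivAt (fun t : ℝ => t ^ (1 + ε)) ((1 + ε) * t ^ (1 + ε - 1)) t :=
    Real.hasDerivAt_rpow_const (Or.inl ht.ne')
  have h := (((h1.div_const ε).mul_const (v * Real.log v - (Q + 1) * v)).sub
    ((((h1.div_const ε).mul (Real.hasDerivAt_log ht.ne')).sub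
      (h1.div_const (ε ^ 2))).const_mul v)).add (h2.div_const (1 + ε))
  refine h.congr_deriv ?_
  rw [show 1 + ε - 1 = ε by ring, Real.rpow_sub_one ht.ne']
  have : 1 + ε ≠ 0 := by positivity
  field_simp
  ring

theorem min_rpow_le_gehringPrimitive {Q g ε : ℝ} (hg : 1 < g) (hQ : g - Real.log g = Q + 1)
    (hε : 0 < ε) (hD : 0 < 1 - ε * (g - 1)) {t v : ℝ} (ht : 0 < t) (hv : 0 < v) :
    min v t ^ (1 + ε) ≤ ε ^ 2 * (1 + ε) * (g ^ (-ε) * (1 - ε * (g - 1))⁻¹) *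
      gehringPrimitive Q ε t v := by
  have hg0 : 0 < g := by linarith
  set C := g ^ (-ε) * (1 - ε * (g - 1))⁻¹ with hC
  have hC0 : 0 < C := by positivity
  have hε1 : 1 + ε ≠ 0 := by positivity
  -- the normalised bound in terms of `r = v / t`
  have base : ∀ r : ℝ, 0 < r → r ≤ 1 → r ^ (1 + ε) ≤
      C * (ε * (1 + ε) * r * (Real.log r - (Q + 1)) + (1 + ε) * r + ε ^ 2) := by
    intro r hr hr1
    have h := mul_rpow_le_log_of_le hg hε hD (u := r * g) (by positivity)
      (by nlinarith)
    rw [Real.mul_rpow hr.le hg0.le, Real.log_mul hr.ne' hg0.ne'] at h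
    have h2 := mul_le_mul_of_nonneg_left h (by positivity : 0 ≤ C * r)
    have hgg : g ^ (-ε) * g ^ ε = 1 := by rw [← Real.rpow_add hg0]; simp
    calc r ^ (1 + ε) = C * r * ((1 - ε * (g - 1)) * (r ^ ε * g ^ ε)) := by
          rw [Real.rpow_add hr, Real.rpow_one, hC]
          have : g ^ (-ε) * (1 - ε * (g - 1))⁻¹ * r * ((1 - ε * (g - 1)) * (r ^ ε * g ^ ε))
            = (g ^ (-ε) * g ^ ε) * ((1 - ε * (g - 1))⁻¹ * (1 - ε * (g - 1))) * (r * r ^ ε) := by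
              ring
          rw [this, hgg, inv_mul_cancel₀ hD.ne']; ring
      _ ≤ _ := h2
      _ = _ := by
          rw [← hQ]; field_simp; ring
  have all : ∀ r : ℝ, 0 < r → min r 1 ^ (1 + ε) ≤
      C * (ε * (1 + ε) * r * (Real.log r - (Q + 1)) + (1 + ε) * r + ε ^ 2) := by
    intro r hr
    rcases le_total r 1 with h | h
    · rw [min_eq_left h]; exact base r hr h
    · rw [min_eq_right h]
      refine (base 1 one_pos le_rfl).trans (mul_le_mul_of_nonneg_left ?_ hC0.le)
      have hlog : r - 1 ≤ r * Real.log r := by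
        have h1 := Real.one_sub_inv_le_log_of_pos hr
        have h2 := mul_le_mul_of_nonneg_left h1 hr.le
        have h3 : r * (1 - r⁻¹) = r - 1 := by field_simp
        linarith
      have hQε : ε * Q ≤ 1 := by
        have : 0 ≤ Real.log g := Real.log_nonneg hg.le
        nlinarith
      have hp : 0 < ε * (1 + ε) := by positivity
      have h4 := mul_le_mul_of_nonneg_left hlog hp.le
      have h5 : 0 ≤ (1 + ε) * (1 - ε * Q) * (r - 1) :=
        mul_nonneg (mul_nonneg (by positivity) (by linarith)) (by linarith)
      rw [Real.log_one]
      nlinarith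
  have h := mul_le_mul_of_nonneg_left (all (v / t) (by positivity))
    (by positivity : 0 ≤ t ^ (1 + ε))
  have hmin : t ^ (1 + ε) * min (v / t) 1 ^ (1 + ε) = min v t ^ (1 + ε) := by
    rw [← Real.mul_rpow ht.le (by positivity), mul_min_of_nonneg _ _ ht.le]
    congr 2
    · field_simp
    · ring
  rw [hmin] at h
  refine h.trans_eq ?_
  rw [gehringPrimitive, Real.log_div hv.ne' ht.ne', Real.rpow_add ht, Real.rpow_one]
  field_simp
  ring

theorem intervalIntegrable_of_locallyIntegrable {f : ℝ → ℝ} (hf : LocallyIntegrable f) (a b : ℝ) :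
    IntervalIntegrable f volume a b :=
  (hf.integrableOn_isCompact isCompact_uIcc).intervalIntegrable

/-- The primitive of `w - l` vanishing at `a`. -/
noncomputable def excess (w : ℝ → ℝ) (a l x : ℝ) : ℝ := (∫ t in a..x, w t) - l * (x - a)

theorem continuous_excess {w : ℝ → ℝ} (hw : LocallyIntegrable w) (a l : ℝ) :
    Continuous (excess w a l) :=
  (intervalIntegral.continuous_primitive (intervalIntegrable_of_locallyIntegrable hw) a).sub
    (by fun_prop)

theorem excess_right_nonpos {w : ℝ → ℝ} {a b l : ℝ} (hab : a < b) (hl : intAvg w a b ≤ l) :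
    excess w a l b ≤ 0 := by
  rw [intAvg, inv_mul_le_iff₀ (sub_pos.2 hab)] at hl
  rw [excess]; linarith

theorem setIntegral_riseSet_nonpos {Q : ℝ} {w : ℝ → ℝ} (hw : LocallyIntegrable w)
    (hwlog : LocallyIntegrable (fun t => w t * Real.log (w t)))
    (hRH : ∀ a b : ℝ, a < b →
      intAvg (fun t => w t * Real.log (w t)) a b ≤
        intAvg w a b * Real.log (intAvg w a b) + Q * intAvg w a b)
    {a b l : ℝ} (hab : a < b) (hl : intAvg w a b ≤ l) :
    ∫ t in riseSet (excess w a l) a b,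
      (w t * Real.log (w t) - (Q + 1) * w t - w t * Real.log l + l) ≤ 0 := by
  have hF := continuous_excess hw a l
  have hsub : riseSet (excess w a l) a b ⊆ Ioo a b := fun x hx => hx.1
  refine setIntegral_nonpos_of_forall_component (isOpen_riseSet hF a b)
    (bddBelow_Ioo.mono hsub) (bddAbove_Ioo.mono hsub) ?_ ?_
  · have i1 := hw.integrableOn_isCompact (isCompact_Icc (a := a) (b := b))
    have i2 := hwlog.integrableOn_isCompact (isCompact_Icc (a := a) (b := b))
    exact (((i2.sub (i1.const_mul (Q + 1))).sub (i1.mul_const (Real.log l))).add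
      (integrable_const l)).mono_set (hsub.trans Ioo_subset_Icc_self)
  · intro c e hce hceU hc he
    obtain ⟨-, -, heq⟩ := eq_of_riseSet_component hF (by simp [excess])
      (excess_right_nonpos hab hl) hce hceU hc he
    have i1 := intervalIntegrable_of_locallyIntegrable hw c e
    have i2 := intervalIntegrable_of_locallyIntegrable hwlog c e
    have hadd := intervalIntegral.integral_add_adjacent_intervals
      (intervalIntegrable_of_locallyIntegrable hw a c) i1
    have hint : ∫ t in c..e, w t = l * (e - c) := by
      simp only [excess] at heq; linarith
    have hpos : 0 < e - c := sub_pos.2 hce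
    have havg : intAvg w c e = l := by
      rw [intAvg, hint]; field_simp
    have h := hRH c e hce
    rw [havg, intAvg, inv_mul_le_iff₀ hpos] at h
    rw [intervalIntegral.integral_add ((i2.sub (i1.const_mul _)).sub (i1.mul_const _))
        intervalIntegrable_const,
      intervalIntegral.integral_sub (i2.sub (i1.const_mul _)) (i1.mul_const _),
      intervalIntegral.integral_sub i2 (i1.const_mul _),
      intervalIntegral.integral_const_mul, intervalIntegral.integral_mul_const,
      intervalIntegral.integral_const, hint, smul_eq_mul]
    nlinarith

theorem riseSet_excess_anti {w : ℝ → ℝ} {a b l l' : ℝ} (h : l ≤ l') :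
    riseSet (excess w a l') a b ⊆ riseSet (excess w a l) a b := by
  rintro x ⟨hx, y, hy, hxy⟩
  refine ⟨hx, y, hy, ?_⟩
  simp only [excess, min_lt_iff] at hxy ⊢
  rcases hxy with hxy | hxy
  · left; nlinarith [mul_le_mul_of_nonneg_right h (sub_nonneg.2 hy.1.le)]
  · right; nlinarith [mul_le_mul_of_nonneg_right h (by linarith [hx.1, hy.1] : 0 ≤ y - a)]

theorem exists_gt_mem_riseSet {w : ℝ → ℝ} {a b l N x : ℝ} (hl : l < N)
    (hx : x ∈ riseSet (excess w a l) a b) :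
    ∃ l' ∈ Ioo l N, x ∈ riseSet (excess w a l') a b := by
  obtain ⟨hx, y, hy, hxy⟩ := hx
  have hcont : ∀ z, Continuous fun l => excess w a l z := fun z => by
    unfold excess; fun_prop
  have h1 : ∀ᶠ l' in 𝓝[>] l, min (excess w a l' x) 0 < excess w a l' y :=
    (((hcont x).min continuous_const).continuousAt.eventually_lt
      (hcont y).continuousAt hxy).filter_mono nhdsWithin_le_nhds
  obtain ⟨l', h, h'⟩ := (h1.and (Ioo_mem_nhdsGT hl)).exists
  exact ⟨l', h', hx, y, hy, h⟩

/-- The maximal function associated with `riseSet`, truncated to `[l₀, N]`. -/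
noncomputable def truncMax (w : ℝ → ℝ) (a b l₀ N x : ℝ) : ℝ :=
  sSup {l | l ∈ Icc l₀ N ∧ (l = l₀ ∨ x ∈ riseSet (excess w a l) a b)}

theorem truncMax_mem {w : ℝ → ℝ} {a b l₀ N : ℝ} (h : l₀ ≤ N) (x : ℝ) :
    truncMax w a b l₀ N x ∈ Icc l₀ N :=
  ⟨le_csSup ⟨N, fun _ hl => hl.1.2⟩ ⟨left_mem_Icc.2 h, Or.inl rfl⟩,
    csSup_le ⟨l₀, left_mem_Icc.2 h, Or.inl rfl⟩ fun _ hl => hl.1.2⟩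

theorem lt_truncMax_iff {w : ℝ → ℝ} {a b l₀ N l x : ℝ} (hl : l ∈ Ico l₀ N) :
    l < truncMax w a b l₀ N x ↔ x ∈ riseSet (excess w a l) a b := by
  have h : l₀ ≤ N := hl.1.trans hl.2.le
  constructor
  · intro hlt
    have hne : {l | l ∈ Icc l₀ N ∧ (l = l₀ ∨ x ∈ riseSet (excess w a l) a b)}.Nonempty :=
      ⟨l₀, left_mem_Icc.2 h, Or.inl rfl⟩
    obtain ⟨l', ⟨-, h2⟩, h3⟩ := exists_lt_of_lt_csSup hne hlt
    rcases h2 with rfl | h2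
    · exact absurd hl.1 (not_le.2 h3)
    · exact riseSet_excess_anti h3.le h2
  · intro hx
    obtain ⟨l', hl', hx'⟩ := exists_gt_mem_riseSet hl.2 hx
    refine hl'.1.trans_le (le_csSup ⟨N, fun _ hl => hl.1.2⟩ ?_)
    exact ⟨⟨hl.1.trans hl'.1.le, hl'.2.le⟩, Or.inr hx'⟩

theorem measurable_truncMax {w : ℝ → ℝ} (hw : LocallyIntegrable w) {a b l₀ N : ℝ} (h : l₀ ≤ N) :
    Measurable (truncMax w a b l₀ N) := by
  refine measurable_of_Ioi fun l => ?_
  rcases lt_or_ge l l₀ with h1 | h1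
  · convert MeasurableSet.univ
    exact eq_univ_of_forall fun x => h1.trans_le (truncMax_mem h x).1
  rcases lt_or_ge l N with h2 | h2
  · have : truncMax w a b l₀ N ⁻¹' Ioi l = riseSet (excess w a l) a b := by
      ext x; exact lt_truncMax_iff ⟨h1, h2⟩
    rw [this]
    exact (isOpen_riseSet (continuous_excess hw a l) a b).measurableSet
  · convert MeasurableSet.empty
    exact eq_empty_of_forall_notMem fun x hx => absurd ((truncMax_mem h x).2.trans h2) (not_le.2 hx)

theorem ae_min_le_truncMax {w : ℝ → ℝ} (hw : LocallyIntegrable w) {a b l₀ N : ℝ} (h : l₀ ≤ N) :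
    ∀ᵐ x, x ∈ Ioo a b → min (w x) N ≤ truncMax w a b l₀ N x := by
  filter_upwards [_root_.LocallyIntegrable.ae_hasDerivAt_integral hw] with x hx hxab
  by_contra! hlt
  obtain ⟨hwx, hN⟩ := lt_min_iff.1 hlt
  obtain ⟨l, hl1, hl2⟩ := exists_between hlt
  obtain ⟨hlw, hlN⟩ := lt_min_iff.1 hl2
  have hnot : x ∉ riseSet (excess w a l) a b := fun hmem =>
    absurd ((lt_truncMax_iff ⟨(truncMax_mem h x).1.trans hl1.le, hlN⟩).2 hmem) (not_lt.2 hl1.le)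
  have hd : HasDerivAt (excess w a l) (w x - l) x := by
    refine ((hx a).sub (((hasDerivAt_id x).sub_const a).const_mul l)).congr_deriv ?_
    rw [mul_one]
  have hsl := (hasDerivAt_iff_tendsto_slope_left_right.1 hd).2
  have hev : ∀ᶠ y in 𝓝[>] x, slope (excess w a l) x y ≤ 0 := by
    filter_upwards [Ioo_mem_nhdsGT hxab.2] with y hy
    have : excess w a l y ≤ min (excess w a l x) 0 := by
      by_contra! hc
      exact hnot ⟨hxab, y, ⟨hy.1, hy.2.le⟩, hc⟩
    rw [slope_def_field]
    exact div_nonpos_of_nonpos_of_nonneg (by linarith [min_le_left (excess w a l x) 0])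
      (by linarith [hy.1])
  have := le_of_tendsto hsl hev
  linarith

theorem setIntegral_gehringPrimitive_truncMax_le {Q ε : ℝ} (hε : 0 < ε) {w : ℝ → ℝ}
    (hw : LocallyIntegrable w)
    (hwlog : LocallyIntegrable (fun t => w t * Real.log (w t)))
    (hRH : ∀ a b : ℝ, a < b →
      intAvg (fun t => w t * Real.log (w t)) a b ≤
        intAvg w a b * Real.log (intAvg w a b) + Q * intAvg w a b)
    {a b N : ℝ} (hab : a < b) (hl₀ : 0 < intAvg w a b) (hN : intAvg w a b < N) :
    IntegrableOn (fun x => gehringPrimitive Q ε (truncMax w a b (intAvg w a b) N x) (w x)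
        - gehringPrimitive Q ε (intAvg w a b) (w x)) (Ioc a b) ∧
      ∫ x in Ioc a b, (gehringPrimitive Q ε (truncMax w a b (intAvg w a b) N x) (w x)
        - gehringPrimitive Q ε (intAvg w a b) (w x)) ≤ 0 := by
  set l₀ := intAvg w a b with hl₀def
  set T := truncMax w a b l₀ N with hT
  have hTmem : ∀ x, T x ∈ Icc l₀ N := truncMax_mem hN.le
  have hTm : Measurable T := measurable_truncMax hw hN.le
  let μ : Measure ℝ := volume.restrict (Ioc a b)
  let ν : Measure ℝ := volume.restrict (Ioc l₀ N)
  let ψ : ℝ → ℝ → ℝ := fun l v => v * Real.log v - (Q + 1) * v - v * Real.log l + l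
  let S : Set (ℝ × ℝ) := {p | p.2 < T p.1}
  have hS : MeasurableSet S := measurableSet_lt measurable_snd (hTm.comp measurable_fst)
  let f : ℝ × ℝ → ℝ := S.indicator fun p => p.2 ^ (ε - 1) * ψ p.2 (w p.1)
  have hcont : ∀ {g : ℝ → ℝ}, ContinuousOn g (Ioi 0) → Integrable g ν := fun {g} hg =>
    ((hg.mono fun x hx => hl₀.trans_le hx.1).integrableOn_Icc
      (a := l₀) (b := N)).mono_set Ioc_subset_Icc_self
  have hpow : ∀ s : ℝ, ContinuousOn (fun x : ℝ => x ^ s) (Ioi 0) := fun s x hx =>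
    (Real.continuousAt_rpow_const _ _ (Or.inl (ne_of_gt hx))).continuousWithinAt
  have hlog : ContinuousOn Real.log (Ioi 0) := fun x hx =>
    (Real.continuousAt_log (ne_of_gt hx)).continuousWithinAt
  have iw : Integrable w μ :=
    (hw.integrableOn_isCompact isCompact_Icc).mono_set Ioc_subset_Icc_self
  have iwl : Integrable (fun t => w t * Real.log (w t)) μ :=
    (hwlog.integrableOn_isCompact isCompact_Icc).mono_set Ioc_subset_Icc_self
  have hf : Integrable f (μ.prod ν) := by
    refine Integrable.indicator ?_ hS
    have h1 := (iwl.sub (iw.const_mul (Q + 1))).mul_prod (hcont (hpow (ε - 1)))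
    have h2 := iw.mul_prod (hcont ((hpow (ε - 1)).mul hlog))
    have h3 := (integrable_const (1 : ℝ) (μ := μ)).mul_prod
      (hcont ((hpow (ε - 1)).mul continuousOn_id))
    refine ((h1.sub h2).add h3).congr (Eventually.of_forall fun p => ?_)
    simp only [Pi.add_apply, Pi.sub_apply, Pi.mul_apply, id, ψ]
    ring
  have hinner : ∀ x, ∫ l, f (x, l) ∂ν =
      gehringPrimitive Q ε (T x) (w x) - gehringPrimitive Q ε l₀ (w x) := by
    intro x
    have hsec : (fun l => f (x, l)) =
        (Iio (T x)).indicator fun l => l ^ (ε - 1) * ψ l (w x) := by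
      ext l; simp only [f, S, indicator_apply, mem_ofPred_eq, mem_Iio]
    have hset : Iio (T x) ∩ Ioc l₀ N = Ioo l₀ (T x) := by
      ext l
      simp only [mem_inter_iff, mem_Iio, mem_Ioc, mem_Ioo]
      exact ⟨fun h => ⟨h.2.1, h.1⟩, fun h => ⟨h.2, h.1, h.2.le.trans (hTmem x).2⟩⟩
    rw [hsec, integral_indicator measurableSet_Iio, Measure.restrict_restrict measurableSet_Iio,
      hset, ← integral_Ioc_eq_integral_Ioo, ← intervalIntegral.integral_of_le (hTmem x).1]
    refine intervalIntegral.integral_eq_sub_of_hasDerivAt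
      (f := fun t => gehringPrimitive Q ε t (w x)) ?_ ?_
    · intro l hl
      rw [uIcc_of_le (hTmem x).1] at hl
      exact hasDerivAt_gehringPrimitive hε (hl₀.trans_le hl.1)
    · refine ContinuousOn.intervalIntegrable ?_
      rw [uIcc_of_le (hTmem x).1]
      refine ContinuousOn.mono (s := Ioi 0) ?_ fun l hl => hl₀.trans_le hl.1
      exact (hpow _).mul ((continuousOn_const.sub (continuousOn_const.mul hlog)).add continuousOn_id)
  have houter : ∀ᵐ l ∂ν, ∫ x, f (x, l) ∂μ ≤ 0 := by
    filter_upwards [ae_restrict_mem measurableSet_Ioc] with l hl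
    rcases hl.2.eq_or_lt with rfl | hlN
    · refine (integral_eq_zero_of_ae (Eventually.of_forall fun x => ?_)).le
      exact indicator_of_notMem (show (x, l) ∉ S from not_lt.2 (hTmem x).2) _
    · have hsec : (fun x => f (x, l)) =
          (riseSet (excess w a l) a b).indicator fun x => l ^ (ε - 1) * ψ l (w x) := by
        ext x
        have : (x, l) ∈ S ↔ x ∈ riseSet (excess w a l) a b := lt_truncMax_iff ⟨hl.1.le, hlN⟩
        by_cases hx : (x, l) ∈ S
        · rw [indicator_of_mem (this.1 hx)]; exact indicator_of_mem hx _
        · rw [indicator_of_notMem (fun h => hx (this.2 h))]; exact indicator_of_notMem hx _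
      have hm : MeasurableSet (riseSet (excess w a l) a b) :=
        (isOpen_riseSet (continuous_excess hw a l) a b).measurableSet
      rw [hsec, integral_indicator hm, Measure.restrict_restrict hm,
        inter_eq_left.2 fun x hx => Ioo_subset_Ioc_self hx.1, integral_const_mul]
      exact mul_nonpos_of_nonneg_of_nonpos (Real.rpow_nonneg (hl₀.trans hl.1).le _)
        (setIntegral_riseSet_nonpos hw hwlog hRH hab hl.1.le)
  have hI := hf.integral_prod_left
  simp only [hinner] at hI
  refine ⟨hI, ?_⟩
  have hswap := integral_integral_swap (f := fun x l => f (x, l)) hf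
  simp only [hinner] at hswap
  exact hswap.trans_le (integral_nonpos_of_ae houter)

theorem integral_gehringPrimitive_average_le {Q ε : ℝ} (hε : 0 < ε) {w : ℝ → ℝ}
    (hw : LocallyIntegrable w)
    (hwlog : LocallyIntegrable (fun t => w t * Real.log (w t)))
    {a b : ℝ} (hab : a < b) (hl₀ : 0 < intAvg w a b)
    (hRH : intAvg (fun t => w t * Real.log (w t)) a b ≤
        intAvg w a b * Real.log (intAvg w a b) + Q * intAvg w a b) :
    IntegrableOn (fun x => gehringPrimitive Q ε (intAvg w a b) (w x)) (Ioc a b) ∧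
      ε ^ 2 * (1 + ε) * ∫ x in Ioc a b, gehringPrimitive Q ε (intAvg w a b) (w x) ≤
        (b - a) * intAvg w a b ^ (1 + ε) := by
  set l := intAvg w a b with hl
  have hpos : 0 < b - a := sub_pos.2 hab
  have hint : ∫ t in a..b, w t = (b - a) * l := by
    rw [hl, intAvg]; field_simp
  rw [intAvg, inv_mul_le_iff₀ hpos] at hRH
  have i1 := intervalIntegrable_of_locallyIntegrable hw a b
  have i2 := intervalIntegrable_of_locallyIntegrable hwlog a b
  have i3 := ((i2.sub (i1.const_mul (Q + 1))).const_mul (l ^ ε / ε))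
  have i4 := i1.mul_const (l ^ ε / ε * Real.log l - l ^ ε / ε ^ 2)
  have i5 : IntervalIntegrable (fun _ : ℝ => l ^ (1 + ε) / (1 + ε)) volume a b :=
    intervalIntegrable_const
  refine ⟨((intervalIntegrable_iff_integrableOn_Ioc_of_le hab.le).1 ((i3.sub i4).add i5)), ?_⟩
  rw [← intervalIntegral.integral_of_le hab.le]
  unfold gehringPrimitive
  rw [intervalIntegral.integral_add (i3.sub i4) i5, intervalIntegral.integral_sub i3 i4,
    intervalIntegral.integral_const_mul, intervalIntegral.integral_mul_const,
    intervalIntegral.integral_sub i2 (i1.const_mul _), intervalIntegral.integral_const_mul,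
    intervalIntegral.integral_const, hint, smul_eq_mul]
  have hle : 0 < l ^ ε := Real.rpow_pos_of_pos hl₀ _
  have h2 := mul_le_mul_of_nonneg_left hRH (by positivity : 0 ≤ ε * (1 + ε) * l ^ ε)
  have h1ε : 1 + ε ≠ 0 := by positivity
  rw [Real.rpow_add hl₀, Real.rpow_one]
  calc _ = ε * (1 + ε) * l ^ ε * (∫ t in a..b, w t * Real.log (w t))
        - ε * (1 + ε) * l ^ ε * ((Q + 1) * ((b - a) * l) + (b - a) * l * Real.log l)
        + (1 + ε) * l ^ ε * ((b - a) * l) + ε ^ 2 * ((b - a) * (l * l ^ ε)) := by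
        field_simp
        ring
    _ ≤ _ := by nlinarith

theorem intAvg_pos {w : ℝ → ℝ} (hw : LocallyIntegrable w) (hpos : ∀ᵐ t ∂volume, 0 < w t)
    {a b : ℝ} (hab : a < b) : 0 < intAvg w a b := by
  refine mul_pos (inv_pos.2 (sub_pos.2 hab)) ?_
  rw [intervalIntegral.integral_of_le hab.le]
  have hnn : 0 ≤ᵐ[volume.restrict (Ioc a b)] w :=
    ae_restrict_of_ae (hpos.mono fun _ h => h.le)
  have hint : IntegrableOn w (Ioc a b) :=
    (hw.integrableOn_isCompact isCompact_Icc).mono_set Ioc_subset_Icc_self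
  refine lt_of_le_of_ne (integral_nonneg_of_ae hnn) fun h => ?_
  have hzero := (integral_eq_zero_iff_of_nonneg_ae hnn hint).1 h.symm
  have hfalse : ∀ᵐ _t ∂volume.restrict (Ioc a b), False := by
    filter_upwards [hzero, ae_restrict_of_ae hpos] with t h1 h2
    exact h2.ne' h1
  rw [eventually_false_iff_eq_bot, ae_eq_bot, Measure.restrict_eq_zero, Real.volume_Ioc,
    ENNReal.ofReal_eq_zero] at hfalse
  linarith

theorem integral_min_rpow_le {Q g ε : ℝ} (hg : 1 < g) (hQ : g - Real.log g = Q + 1)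
    (hε : 0 < ε) (hD : 0 < 1 - ε * (g - 1)) {w : ℝ → ℝ}
    (hw : LocallyIntegrable w) (hpos : ∀ᵐ t ∂volume, 0 < w t)
    (hwlog : LocallyIntegrable (fun t => w t * Real.log (w t)))
    (hRH : ∀ a b : ℝ, a < b →
      intAvg (fun t => w t * Real.log (w t)) a b ≤
        intAvg w a b * Real.log (intAvg w a b) + Q * intAvg w a b)
    {a b N : ℝ} (hab : a < b) (hN : intAvg w a b < N) :
    IntegrableOn (fun x => min (w x) N ^ (1 + ε)) (Ioc a b) ∧
      ∫ x in Ioc a b, min (w x) N ^ (1 + ε) ≤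
        (b - a) * (g ^ (-ε) * (1 - ε * (g - 1))⁻¹ * intAvg w a b ^ (1 + ε)) := by
  have hl₀ := intAvg_pos hw hpos hab
  have hg0 : 0 < g := by linarith
  obtain ⟨i1, h1⟩ := setIntegral_gehringPrimitive_truncMax_le hε hw hwlog hRH hab hl₀ hN
  obtain ⟨i2, h2⟩ := integral_gehringPrimitive_average_le hε hw hwlog hab hl₀ (hRH a b hab)
  set l₀ := intAvg w a b
  set C := g ^ (-ε) * (1 - ε * (g - 1))⁻¹ with hC
  have hC0 : 0 < C := by positivity
  have hN0 : 0 < N := hl₀.trans hN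
  have hposI := ae_restrict_of_ae (s := Ioc a b) hpos
  have iw : IntegrableOn w (Ioc a b) :=
    (hw.integrableOn_isCompact isCompact_Icc).mono_set Ioc_subset_Icc_self
  have imin : IntegrableOn (fun x => min (w x) N ^ (1 + ε)) (Ioc a b) := by
    refine Integrable.mono' (integrable_const (N ^ (1 + ε))) ?_ ?_
    · exact ((iw.aemeasurable.min aemeasurable_const).pow_const _).aestronglyMeasurable
    · filter_upwards [hposI] with x hx
      have hm : 0 < min (w x) N := lt_min hx hN0
      rw [Real.norm_of_nonneg (by positivity)]
      exact Real.rpow_le_rpow hm.le (min_le_right _ _) (by positivity)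
  have hae : ∀ᵐ x ∂volume.restrict (Ioc a b),
      min (w x) N ≤ truncMax w a b l₀ N x := by
    rw [← restrict_Ioo_eq_restrict_Ioc]
    exact (ae_restrict_iff' measurableSet_Ioo).2 (ae_min_le_truncMax hw hN.le)
  have i3 := i1.add i2
  refine ⟨imin, ?_⟩
  calc ∫ x in Ioc a b, min (w x) N ^ (1 + ε)
      ≤ ∫ x in Ioc a b, ε ^ 2 * (1 + ε) * C *
          ((gehringPrimitive Q ε (truncMax w a b l₀ N x) (w x) - gehringPrimitive Q ε l₀ (w x))
            + gehringPrimitive Q ε l₀ (w x)) := by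
        refine integral_mono_ae imin (i3.const_mul _) ?_
        filter_upwards [hposI, hae] with x hx hxT
        have hT0 : 0 < truncMax w a b l₀ N x := hl₀.trans_le (truncMax_mem hN.le x).1
        simp only [sub_add_cancel]
        refine le_trans ?_ (min_rpow_le_gehringPrimitive hg hQ hε hD hT0 hx)
        exact Real.rpow_le_rpow (lt_min hx hN0).le (le_min (min_le_left _ _) hxT) (by positivity)
    _ = C * (ε ^ 2 * (1 + ε) * (∫ x in Ioc a b,
          (gehringPrimitive Q ε (truncMax w a b l₀ N x) (w x) - gehringPrimitive Q ε l₀ (w x))) +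
        ε ^ 2 * (1 + ε) * ∫ x in Ioc a b, gehringPrimitive Q ε l₀ (w x)) := by
        rw [integral_const_mul, integral_add i1 i2]; ring
    _ ≤ C * (0 + (b - a) * l₀ ^ (1 + ε)) := by
        refine mul_le_mul_of_nonneg_left (add_le_add ?_ h2) hC0.le
        exact mul_nonpos_of_nonneg_of_nonpos (by positivity) h1
    _ = _ := by ring

/-- If the integrals of the truncated powers are bounded, then so is the integral of the power. -/
theorem integrable_rpow_of_integral_min_le {α : Type*} [MeasurableSpace α] {μ : Measure α}
    {w : α → ℝ} (hwm : AEMeasurable w μ) (hw : ∀ᵐ x ∂μ, 0 < w x) {p K N₀ : ℝ}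
    (h : ∀ N, N₀ < N → Integrable (fun x => min (w x) N ^ p) μ ∧ ∫ x, min (w x) N ^ p ∂μ ≤ K) :
    Integrable (fun x => w x ^ p) μ ∧ ∫ x, w x ^ p ∂μ ≤ K := by
  have hnn : ∀ᵐ x ∂μ, 0 ≤ w x ^ p := hw.mono fun x hx => Real.rpow_nonneg hx.le _
  have hmeas : ∀ n : ℕ, AEMeasurable (fun x => ENNReal.ofReal (min (w x) n ^ p)) μ := fun n =>
    ((hwm.min aemeasurable_const).pow_const p).ennreal_ofReal
  have hlim : ∀ x, liminf (fun n : ℕ => ENNReal.ofReal (min (w x) n ^ p)) atTop =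
      ENNReal.ofReal (w x ^ p) := by
    intro x
    refine (tendsto_const_nhds.congr' ?_).liminf_eq
    filter_upwards [eventually_ge_atTop ⌈w x⌉₊] with n hn
    rw [min_eq_left (Nat.ceil_le.1 hn)]
  have hK : ∫⁻ x, ENNReal.ofReal (w x ^ p) ∂μ ≤ ENNReal.ofReal K := by
    calc ∫⁻ x, ENNReal.ofReal (w x ^ p) ∂μ
        = ∫⁻ x, liminf (fun n : ℕ => ENNReal.ofReal (min (w x) n ^ p)) atTop ∂μ := by
          simp only [hlim]
      _ ≤ liminf (fun n : ℕ => ∫⁻ x, ENNReal.ofReal (min (w x) n ^ p) ∂μ) atTop :=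
          lintegral_liminf_le' hmeas
      _ ≤ ENNReal.ofReal K := by
          refine liminf_le_of_frequently_le' (Eventually.frequently ?_)
          filter_upwards [eventually_gt_atTop ⌈N₀⌉₊] with n hn
          obtain ⟨hi, hle⟩ := h n (Nat.lt_of_ceil_lt hn)
          rw [← ofReal_integral_eq_lintegral_ofReal hi
            (hw.mono fun x hx => Real.rpow_nonneg (le_min hx.le n.cast_nonneg) _)]
          exact ENNReal.ofReal_le_ofReal hle
  have hint : Integrable (fun x => w x ^ p) μ :=
    ⟨(hwm.pow_const p).aestronglyMeasurable,
      (hasFiniteIntegral_iff_ofReal hnn).2 (hK.trans_lt ENNReal.ofReal_lt_top)⟩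
  refine ⟨hint, ?_⟩
  have hK0 : 0 ≤ K := by
    obtain ⟨-, hle⟩ := h (max N₀ 0 + 1) (by linarith [le_max_left N₀ 0])
    refine le_trans (integral_nonneg_of_ae (hw.mono fun x hx => ?_)) hle
    exact Real.rpow_nonneg (le_min hx.le (by linarith [le_max_right N₀ 0])) _
  rw [← ofReal_integral_eq_lintegral_ofReal hint hnn] at hK
  exact (ENNReal.ofReal_le_ofReal_iff hK0).1 hK

end Helpers

/-- **Sharp Gehring Lemma (`n = 1`, `p = 1`).**
Let `Q > 0`, let `ε₋` be the unique positive solution of `1/t − log(1/t + 1) = Q`, and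
set `γ₊ = 1 + 1/ε₋` (the larger root of `γ − log γ = Q + 1`). Let `w` be a weight with
`w·log w` locally integrable and `[w]_{RH₁} ≤ Q` (expressed interval-wise). Then for
every `0 < ε < ε₋` and every bounded interval `I` of positive length,
`⟨w^{1+ε}⟩_I ≤ γ₊^{−ε}·(1 − ε(γ₊−1))⁻¹·(⟨w⟩_I)^{1+ε}`; in particular `w ∈ RH_{1+ε}`. -/
theorem sharp_one_gehring_lemma
    (Q : ℝ) (hQ : 0 < Q)
    (εm : ℝ) (hεm : 0 < εm) (hroot : 1/εm - Real.log (1/εm + 1) = Q)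
    (γp : ℝ) (hγp : γp = 1 + 1/εm)
    (w : ℝ → ℝ) (hw : LocallyIntegrable w)
    (hpos : ∀ᵐ t ∂volume, 0 < w t)
    (hwlog : LocallyIntegrable (fun t => w t * Real.log (w t)))
    (hRH : ∀ a b : ℝ, a < b →
      intAvg (fun t => w t * Real.log (w t)) a b ≤
        intAvg w a b * Real.log (intAvg w a b) + Q * intAvg w a b) :
    ∀ ε : ℝ, 0 < ε → ε < εm →
      ∀ a b : ℝ, a < b →
        IntegrableOn (fun t => w t ^ (1+ε)) (Set.Ioc a b) ∧
        intAvg (fun t => w t ^ (1+ε)) a b ≤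
          γp ^ (-ε) * (1 - ε * (γp - 1))⁻¹ * (intAvg w a b) ^ (1+ε) := by
  intro ε hε hεlt a b hab
  have hinv : 0 < 1 / εm := by positivity
  have hg : 1 < γp := by linarith
  have hD : 0 < 1 - ε * (γp - 1) := by
    have : ε * (1 / εm) < 1 := by rw [mul_one_div]; exact (div_lt_one hεm).2 hεlt
    rw [hγp]; linarith
  have hroot' : γp - Real.log γp = Q + 1 := by
    rw [hγp, add_comm 1 (1 / εm)]; linarith
  have iw : IntegrableOn w (Set.Ioc a b) :=
    (hw.integrableOn_isCompact isCompact_Icc).mono_set Set.Ioc_subset_Icc_self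
  obtain ⟨hint, hle⟩ := integrable_rpow_of_integral_min_le iw.aemeasurable
    (ae_restrict_of_ae hpos) fun N hN =>
      integral_min_rpow_le hg hroot' hε hD hw hpos hwlog hRH hab hN
  refine ⟨hint, ?_⟩
  rw [intAvg, intervalIntegral.integral_of_le hab.le, inv_mul_le_iff₀ (sub_pos.2 hab)]
  exact hle
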